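/- Fix reals a > 0, S > 0 and T > 0. For each sufficiently small ε > 0, let x(ε) ∈ [0,1) be the unique solution of g(x(ε)) = (1/12)(1 − a^4 ε^4/36). Then lim_{ε→0⁺} ( X_{⌊S/ε⌋,⌊T/ε⌋}(x(ε)) − 3 ) / ε = x(S,T,a), where x(S,T,a) = −3a − 6a ( e^{−aS} + e^{−aT} − 3 e^{−a(S+T)} + e^{−2a(S+T)} ) / ( (1 − e^{−aS})(1 − e^{−aT})(1 − e^{−a(S+T)}) ). -/

import Mathlib

open Filter

/-- The map `g(x) = x(1+x+x²)/(1+4x+x²)²`. -/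
noncomputable def gfun (x : ℝ) : ℝ := x * (1 + x + x ^ 2) / (1 + 4 * x + x ^ 2) ^ 2

/-- `X_{s,t}(x)`. -/
noncomputable def Xfun (s t : ℕ) (x : ℝ) : ℝ :=
  ((1 - x ^ 3) * (1 - x ^ (s + 1)) * (1 - x ^ (t + 1)) * (1 - x ^ (s + t + 3))) /
    ((1 - x) * (1 - x ^ (s + 3)) * (1 - x ^ (t + 3)) * (1 - x ^ (s + t + 1)))

lemma aux_sq (x a ε : ℝ) (hx0 : 0 ≤ x) (ha : 0 < a) (hε : 0 < ε)
    (h : gfun x = (1/12) * (1 - a ^ 4 * ε ^ 4 / 36)) :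
    (1 - x) ^ 2 = (a * ε) ^ 2 * ((1 + 4 * x + x ^ 2) / 6) := by
  have hD : 0 < 1 + 4 * x + x ^ 2 := by positivity
  unfold gfun at h
  rw [div_eq_iff (by positivity)] at h
  have h4 : ((1 - x) ^ 2) ^ 2 = ((a * ε) ^ 2 * ((1 + 4 * x + x ^ 2) / 6)) ^ 2 := by
    linear_combination (-12) * h
  exact (sq_eq_sq₀ (by positivity) (by positivity)).1 h4

lemma aux_floor (S : ℝ) (hS : 0 < S) :
    Tendsto (fun ε : ℝ => (⌊S / ε⌋₊ : ℝ) * ε) (nhdsWithin 0 (Set.Ioi (0:ℝ))) (nhds S) := by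
  have h1 : Tendsto (fun ε : ℝ => S / ε) (nhdsWithin 0 (Set.Ioi (0:ℝ))) atTop := by
    simpa [div_eq_mul_inv] using tendsto_inv_nhdsGT_zero.const_mul_atTop hS
  have h2 := ((tendsto_nat_floor_div_atTop (R := ℝ)).comp h1).mul_const S
  rw [one_mul] at h2
  refine h2.congr' ?_
  filter_upwards [self_mem_nhdsWithin] with ε hε
  have hε' : ε ≠ 0 := ne_of_gt hε
  simp only [Function.comp]
  field_simp

lemma aux_id (x A B ε : ℝ) (hx : 1 - x ≠ 0) (hA : 1 - x ^ 3 * A ≠ 0) (hB : 1 - x ^ 3 * B ≠ 0)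
    (hAB : 1 - x * (A * B) ≠ 0) :
    ((1 - x) / ε) * (-(x + 2) * ((1 - x * A) / (1 - x ^ 3 * A)) * ((1 - x * B) / (1 - x ^ 3 * B))
        * ((1 - x ^ 3 * (A * B)) / (1 - x * (A * B)))
      - 3 * (x * (1 + x) * A / (1 - x ^ 3 * A)) * ((1 - x * B) / (1 - x ^ 3 * B))
        * ((1 - x ^ 3 * (A * B)) / (1 - x * (A * B)))
      - 3 * (x * (1 + x) * B / (1 - x ^ 3 * B)) * ((1 - x ^ 3 * (A * B)) / (1 - x * (A * B)))
      + 3 * (x * (1 + x) * (A * B) / (1 - x * (A * B))))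
    = (((1 - x ^ 3) * (1 - x * A) * (1 - x * B) * (1 - x ^ 3 * (A * B))) /
    ((1 - x) * (1 - x ^ 3 * A) * (1 - x ^ 3 * B) * (1 - x * (A * B))) - 3) / ε := by
  have e0 : (1 - x ^ 3) / (1 - x) = 3 + (1 - x) * (-(x + 2)) := by
    field_simp; ring
  have eA : x * (1 + x) * A / (1 - x ^ 3 * A) * (1 - x) = 1 - (1 - x * A) / (1 - x ^ 3 * A) := by
    field_simp; ring
  have eB : x * (1 + x) * B / (1 - x ^ 3 * B) * (1 - x) = 1 - (1 - x * B) / (1 - x ^ 3 * B) := by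
    field_simp; ring
  have eC : x * (1 + x) * (A * B) / (1 - x * (A * B)) * (1 - x)
      = (1 - x ^ 3 * (A * B)) / (1 - x * (A * B)) - 1 := by
    generalize A * B = C at *
    field_simp; ring
  rw [mul_div_mul_comm, mul_div_mul_comm, mul_div_mul_comm, e0]
  rw [div_mul_eq_mul_div]
  congr 1
  generalize (1 - x * A) / (1 - x ^ 3 * A) = Y at *
  generalize (1 - x * B) / (1 - x ^ 3 * B) = Z at *
  generalize (1 - x ^ 3 * (A * B)) / (1 - x * (A * B)) = W at *
  generalize x * (1 + x) * A / (1 - x ^ 3 * A) = p at *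
  generalize x * (1 + x) * B / (1 - x ^ 3 * B) = q at *
  generalize x * (1 + x) * (A * B) / (1 - x * (A * B)) = r at *
  linear_combination (-3 * Z * W) * eA - 3 * W * eB + 3 * eC

/-- Scaling limit: if `x(ε) ∈ [0,1)` solves `g(x(ε)) = (1/12)(1 − a⁴ε⁴/36)` for small `ε > 0`,
then `(X_{⌊S/ε⌋,⌊T/ε⌋}(x(ε)) − 3)/ε → x(S,T,a)` as `ε → 0⁺`, where
`x(S,T,a) = −3a − 6a(e^{−aS} + e^{−aT} − 3e^{−a(S+T)} + e^{−2a(S+T)}) /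
  ((1−e^{−aS})(1−e^{−aT})(1−e^{−a(S+T)}))`. -/
theorem Xfun_scaling_limit (a S T : ℝ) (ha : 0 < a) (hS : 0 < S) (hT : 0 < T) (xf : ℝ → ℝ)
    (hxf : ∀ᶠ ε in nhdsWithin 0 (Set.Ioi (0:ℝ)),
      xf ε ∈ Set.Ico (0:ℝ) 1 ∧ gfun (xf ε) = (1/12) * (1 - a ^ 4 * ε ^ 4 / 36)) :
    Tendsto (fun ε : ℝ => (Xfun ⌊S / ε⌋₊ ⌊T / ε⌋₊ (xf ε) - 3) / ε)
      (nhdsWithin 0 (Set.Ioi (0:ℝ)))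
      (nhds (-3 * a - 6 * a *
        (Real.exp (-a * S) + Real.exp (-a * T) - 3 * Real.exp (-a * (S + T)) +
          Real.exp (-2 * a * (S + T))) /
        ((1 - Real.exp (-a * S)) * (1 - Real.exp (-a * T)) *
          (1 - Real.exp (-a * (S + T)))))) := by
  set l := nhdsWithin 0 (Set.Ioi (0:ℝ)) with hl
  have hpos : ∀ᶠ ε in l, 0 < ε := self_mem_nhdsWithin
  have hid : Tendsto (fun ε : ℝ => ε) l (nhds 0) := tendsto_nhdsWithin_of_tendsto_nhds tendsto_id
  have hu : Tendsto (fun ε => 1 - xf ε) l (nhds 0) := by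
    have h2 : Tendsto (fun ε : ℝ => a * ε) l (nhds 0) := by simpa using hid.const_mul a
    refine tendsto_of_tendsto_of_tendsto_of_le_of_le' tendsto_const_nhds h2 ?_ ?_
    · filter_upwards [hxf] with ε h
      linarith [h.1.2]
    · filter_upwards [hxf, hpos] with ε h hε
      have h3 := aux_sq _ a ε h.1.1 ha hε h.2
      have h0 := h.1.1
      have h1 := h.1.2
      refine abs_le_of_sq_le_sq' ?_ (by positivity) |>.2
      rw [h3]
      refine mul_le_of_le_one_right (by positivity) ?_
      nlinarith
  have hx : Tendsto xf l (nhds 1) := by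
    have := hu.const_sub 1
    simpa using this
  have hur : Tendsto (fun ε => (1 - xf ε) / ε) l (nhds a) := by
    have h1 : Tendsto (fun ε => a * √((1 + 4 * xf ε + xf ε ^ 2) / 6)) l
        (nhds (a * √((1 + 4 * 1 + 1 ^ 2) / 6))) :=
      (((((hx.const_mul 4).const_add 1).add (hx.pow 2)).div_const 6).sqrt).const_mul a
    have h2 : a * √((1 + 4 * 1 + 1 ^ 2) / 6) = a := by norm_num
    rw [h2] at h1
    refine h1.congr' ?_
    filter_upwards [hxf, hpos] with ε h hε
    have h3 := aux_sq _ a ε h.1.1 ha hε h.2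
    have h0 := h.1.1
    have h4 := h.1.2
    rw [eq_div_iff hε.ne']
    refine (sq_eq_sq₀ (by positivity) (by linarith)).1 ?_
    rw [h3, mul_pow, mul_pow, Real.sq_sqrt (by positivity)]
    ring
  have hxpos : ∀ᶠ ε in l, 0 < xf ε := hx.eventually (lt_mem_nhds one_pos)
  have hlog : Tendsto (fun ε => Real.log (xf ε) / ε) l (nhds (-a)) := by
    have h1 : Tendsto (fun ε => -((1 - xf ε) / ε) / xf ε) l (nhds (-a)) := by
      have h0 := hur.neg.div hx one_ne_zero
      rw [div_one] at h0
      exact h0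
    refine tendsto_of_tendsto_of_tendsto_of_le_of_le' h1 hur.neg ?_ ?_
    · filter_upwards [hxpos, hpos] with ε h hε
      have h5 := Real.one_sub_inv_le_log_of_pos h
      have : -((1 - xf ε) / ε) / xf ε = (1 - (xf ε)⁻¹) / ε := by
        field_simp; ring
      rw [this]
      gcongr
    · filter_upwards [hxpos, hpos] with ε h hε
      have h5 := Real.log_le_sub_one_of_pos h
      rw [← neg_div]
      gcongr
      linarith
  have hpow : ∀ R : ℝ, 0 < R →
      Tendsto (fun ε => xf ε ^ ⌊R / ε⌋₊) l (nhds (Real.exp (-a * R))) := by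
    intro R hR
    have h1 := (Real.continuous_exp.tendsto _).comp (hlog.mul (aux_floor R hR))
    refine h1.congr' ?_
    filter_upwards [hxpos, hpos] with ε h hε
    simp only [Function.comp]
    rw [← Real.rpow_natCast, Real.rpow_def_of_pos h]
    congr 1
    field_simp
  have hA := hpow S hS
  have hB := hpow T hT
  have eAB : Real.exp (-a * (S + T)) = Real.exp (-a * S) * Real.exp (-a * T) := by
    rw [← Real.exp_add]; congr 1; ring
  have eAB2 : Real.exp (-2 * a * (S + T)) = (Real.exp (-a * S) * Real.exp (-a * T)) ^ 2 := by
    rw [← Real.exp_add, ← Real.exp_nat_mul]; congr 1; push_cast; ring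
  have lA : Real.exp (-a * S) < 1 := Real.exp_lt_one_iff.2 (by nlinarith)
  have lB : Real.exp (-a * T) < 1 := Real.exp_lt_one_iff.2 (by nlinarith)
  have pA := Real.exp_pos (-a * S)
  have pB := Real.exp_pos (-a * T)
  rw [eAB, eAB2]
  generalize Real.exp (-a * S) = A at *
  generalize Real.exp (-a * T) = B at *
  have lAB : A * B < 1 := by nlinarith
  have nA : 1 - A ≠ 0 := by linarith
  have nB : 1 - B ≠ 0 := by linarith
  have nAB : 1 - A * B ≠ 0 := by linarith
  have hAB := hA.mul hB
  have num1 : ∀ (k : ℕ) {f : ℝ → ℝ} {c : ℝ}, Tendsto f l (nhds c) →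
      Tendsto (fun ε => 1 - xf ε ^ k * f ε) l (nhds (1 - c)) := by
    intro k f c hf
    simpa using ((hx.pow k).mul hf).const_sub 1
  have num2 : ∀ {f : ℝ → ℝ} {c : ℝ}, Tendsto f l (nhds c) →
      Tendsto (fun ε => xf ε * (1 + xf ε) * f ε) l (nhds (1 * (1 + 1) * c)) := by
    intro f c hf
    exact (hx.mul (hx.const_add 1)).mul hf
  have hY := (num1 1 hA).div (num1 3 hA) nA
  have hZ := (num1 1 hB).div (num1 3 hB) nB
  have hW := (num1 3 hAB).div (num1 1 hAB) nAB
  have hp := (num2 hA).div (num1 3 hA) nA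
  have hq := (num2 hB).div (num1 3 hB) nB
  have hr := (num2 hAB).div (num1 1 hAB) nAB
  have key := hur.mul ((((((hx.add_const 2).neg.mul hY).mul hZ).mul hW).sub
    (((hp.const_mul 3).mul hZ).mul hW)).sub ((hq.const_mul 3).mul hW) |>.add (hr.const_mul 3))
  have hval : -3 * a - 6 * a * (A + B - 3 * (A * B) + (A * B) ^ 2) /
      ((1 - A) * (1 - B) * (1 - A * B)) = a * (-(1 + 2) * ((1 - A) / (1 - A)) *
        ((1 - B) / (1 - B)) * ((1 - A * B) / (1 - A * B))
      - 3 * (1 * (1 + 1) * A / (1 - A)) * ((1 - B) / (1 - B)) * ((1 - A * B) / (1 - A * B))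
      - 3 * (1 * (1 + 1) * B / (1 - B)) * ((1 - A * B) / (1 - A * B))
      + 3 * (1 * (1 + 1) * (A * B) / (1 - A * B))) := by
    rw [div_self nA, div_self nB, div_self nAB]
    field_simp
    ring
  rw [hval]
  refine key.congr' ?_
  filter_upwards [hxf, hxpos] with ε h h0
  have h1 := h.1.2
  have hlt : ∀ n : ℕ, n ≠ 0 → 1 - xf ε ^ n ≠ 0 := fun n hn =>
    (sub_pos.2 (pow_lt_one₀ h0.le h1 hn)).ne'
  have e1 : ∀ n : ℕ, xf ε ^ (n + 1) = xf ε * xf ε ^ n := fun n => by ring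
  have e3 : ∀ n : ℕ, xf ε ^ (n + 3) = xf ε ^ 3 * xf ε ^ n := fun n => by ring
  have := aux_id (xf ε) (xf ε ^ ⌊S / ε⌋₊) (xf ε ^ ⌊T / ε⌋₊) ε (by linarith)
    (by rw [← e3]; exact hlt _ (by omega)) (by rw [← e3]; exact hlt _ (by omega))
    (by rw [← pow_add, ← e1]; exact hlt _ (by omega))
  unfold Xfun
  rw [e1 ⌊S / ε⌋₊, e1 ⌊T / ε⌋₊, e1 (⌊S / ε⌋₊ + ⌊T / ε⌋₊), e3 ⌊S / ε⌋₊, e3 ⌊T / ε⌋₊, e3 (⌊S / ε⌋₊ + ⌊T / ε⌋₊), pow_add (xf ε) ⌊S / ε⌋₊ ⌊T / ε⌋₊, ← this]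
  simp only [pow_one, Pi.div_apply]
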